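/- arXiv:2212.02038 — 7 statements merged into one kernel-verified Lean document; each statement's English description precedes it below -/
import Mathlib

section
/- Let N ≥ 1 and f ≥ 1 be integers. The set of prime numbers p such that (p : ℤ/Nℤ)^f is neither 1 nor −1 is finite if and only if u^f = 1 or u^f = −1 for every unit u of ℤ/Nℤ. -/
/-- Let `N ≥ 1` and `f ≥ 1` be integers. The set of prime numbers `p` such that
`(p : ZMod N) ^ f` is neither `1` nor `-1` is finite if and only if
`u ^ f = 1` or `u ^ f = -1` for every unit `u` of `ZMod N`. -/
theorem stmt0 (N f : ℕ) (hN : 1 ≤ N) (hf : 1 ≤ f) :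
    {p : ℕ | p.Prime ∧ (p : ZMod N) ^ f ≠ 1 ∧ (p : ZMod N) ^ f ≠ -1}.Finite ↔
      ∀ u : (ZMod N)ˣ, u ^ f = 1 ∨ u ^ f = -1 := by
  have : NeZero N := ⟨by lia⟩
  have coe_iff (u : (ZMod N)ˣ) :
      u ^ f = 1 ∨ u ^ f = -1 ↔ (u : ZMod N) ^ f = 1 ∨ (u : ZMod N) ^ f = -1 := by
    simp [Units.ext_iff]
  constructor
  · intro hfin u
    by_contra hu
    rw [coe_iff, not_or] at hu
    refine Nat.infinite_setOfPred_prime_and_eq_mod u.isUnit (hfin.subset ?_)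
    rintro p ⟨hp, hpu⟩
    exact ⟨hp, hpu ▸ hu.1, hpu ▸ hu.2⟩
  · intro h
    refine N.divisors.finite_toSet.subset ?_
    rintro p ⟨hp, h_one, h_neg⟩
    rw [Finset.mem_coe, Nat.mem_divisors]
    refine ⟨?_, by lia⟩
    by_contra hpN
    have hpow := (coe_iff _).1 (h (ZMod.unitOfCoprime p (hp.coprime_iff_not_dvd.2 hpN)))
    rw [ZMod.coe_unitOfCoprime] at hpow
    exact hpow.elim h_one h_neg
end

section
/- Let N > 2 be an integer and let e = λ(N) denote the exponent of the unit group (ℤ/Nℤ)ˣ. Then the least positive integer f such that u^f = 1 or u^f = −1 for every unit u of ℤ/Nℤ equals e/2 if (ℤ/Nℤ)ˣ is cyclic, and equals e if (ℤ/Nℤ)ˣ is not cyclic. -/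
theorem exponent_le_two_mul_of_pow_eq_one_or_neg_one {R : Type*} [Ring R] {f : ℕ} (hf : 0 < f)
    (h : ∀ u : Rˣ, u ^ f = 1 ∨ u ^ f = -1) : Monoid.exponent Rˣ ≤ 2 * f := by
  refine Monoid.exponent_min' _ (by positivity) fun u ↦ ?_
  rw [mul_comm, pow_mul]
  rcases h u with hu | hu <;> simp [hu]

theorem IsCyclic.eq_of_sq_eq_one_of_ne_one {G : Type*} [CommGroup G] [Finite G] [IsCyclic G]
    {x y : G} (hx : x ^ 2 = 1) (hx1 : x ≠ 1) (hy : y ^ 2 = 1) (hy1 : y ≠ 1) : x = y := by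
  classical
  have := Fintype.ofFinite G
  by_contra hxy
  have hle := IsCyclic.card_pow_eq_one_le (α := G) (n := 2) two_pos
  have hsub : ({1, x, y} : Finset G) ⊆ Finset.univ.filter (fun a ↦ a ^ 2 = 1) := by
    intro a ha
    simp only [Finset.mem_insert, Finset.mem_singleton] at ha
    rcases ha with rfl | rfl | rfl <;> simp [*]
  have hcard : ({1, x, y} : Finset G).card = 3 :=
    Finset.card_eq_three.mpr ⟨1, x, y, hx1.symm, hy1.symm, hxy, rfl⟩
  have := Finset.card_le_card hsub
  omega

theorem ZMod.neg_one_ne_one_units {N : ℕ} (hN : 2 < N) : (-1 : (ZMod N)ˣ) ≠ 1 := by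
  have : Fact (2 < N) := ⟨hN⟩
  intro h
  exact ZMod.neg_one_ne_one (n := N) (by simpa using congrArg Units.val h)

theorem ZMod.even_exponent_units {N : ℕ} (hN : 2 < N) : Even (Monoid.exponent (ZMod N)ˣ) := by
  rw [even_iff_two_dvd, ← orderOf_eq_prime (p := 2) (by simp) (ZMod.neg_one_ne_one_units hN)]
  exact Monoid.order_dvd_exponent _

theorem ZMod.units_pow_eq_one_of_coprime_mul_left {a b f : ℕ} (hab : a.Coprime b) (hb : 2 < b)
    (h : ∀ u : (ZMod (a * b))ˣ, u ^ f = 1 ∨ u ^ f = -1) (v : (ZMod a)ˣ) : v ^ f = 1 := by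
  have : Fact (2 < b) := ⟨hb⟩
  let φ := ZMod.chineseRemainder hab
  let w : (ZMod (a * b))ˣ := Units.mapEquiv φ.symm.toMulEquiv (MulEquiv.prodUnits.symm (v, 1))
  have hw : φ (w : ZMod (a * b)) = ((v : ZMod a), (1 : ZMod b)) := φ.apply_symm_apply _
  rcases h w with h1 | h1
  · have h2 := congrArg (fun u : (ZMod (a * b))ˣ ↦ (φ (u : ZMod (a * b))).1) h1
    ext
    simpa [hw] using h2
  · have h2 := congrArg (fun u : (ZMod (a * b))ˣ ↦ (φ (u : ZMod (a * b))).2) h1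
    simp only [Units.val_pow_eq_pow_val, map_pow, hw, Prod.pow_snd, one_pow, Units.val_neg,
      Units.val_one, map_neg, map_one, Prod.snd_neg, Prod.snd_one] at h2
    exact absurd h2.symm ZMod.neg_one_ne_one

theorem ZMod.units_pow_eq_one_of_coprime_mul {a b f : ℕ} (hab : a.Coprime b) (ha : 2 < a) (hb : 2 < b)
    (h : ∀ u : (ZMod (a * b))ˣ, u ^ f = 1 ∨ u ^ f = -1) (u : (ZMod (a * b))ˣ) : u ^ f = 1 := by
  have : Fact (2 < a) := ⟨ha⟩
  refine (h u).resolve_right fun hu ↦ ?_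
  have h1 := ZMod.units_pow_eq_one_of_coprime_mul_left hab hb h (ZMod.unitsMap (dvd_mul_right a b) u)
  rw [← map_pow, hu] at h1
  have h2 := congrArg Units.val h1
  exact ZMod.neg_one_ne_one (n := a) (by simpa [ZMod.unitsMap] using h2)

theorem ZMod.units_pow_eq_one_of_eight_dvd {N f : ℕ} [NeZero N] (hN : 8 ∣ N)
    (h : ∀ u : (ZMod N)ˣ, u ^ f = 1 ∨ u ^ f = -1) (u : (ZMod N)ˣ) : u ^ f = 1 := by
  have hsq : ∀ v : (ZMod 8)ˣ, v ^ 2 = 1 := by decide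
  have hmap : ZMod.unitsMap hN (-1) = -1 := by ext; simp [ZMod.unitsMap]
  refine (h u).resolve_right fun hu ↦ ?_
  rcases Nat.even_or_odd' f with ⟨k, rfl | rfl⟩
  · have h1 := congrArg (ZMod.unitsMap hN) hu
    rw [map_pow, pow_mul, hsq, one_pow, hmap] at h1
    exact absurd h1 (by decide)
  · obtain ⟨w, hw⟩ := ZMod.unitsMap_surjective hN (ZMod.unitOfCoprime 3 (by decide))
    have h1 := (h w).imp (congrArg (ZMod.unitsMap hN)) (congrArg (ZMod.unitsMap hN))
    rw [map_pow, pow_succ, pow_mul, hsq, one_pow, one_mul, hw, hmap, map_one] at h1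
    exact absurd h1 (by decide)

theorem ZMod.eight_dvd_or_exists_coprime_mul_of_not_isCyclic_units {N : ℕ} (hN : 2 < N)
    (hc : ¬ IsCyclic (ZMod N)ˣ) :
    8 ∣ N ∨ ∃ a b : ℕ, a.Coprime b ∧ 2 < a ∧ 2 < b ∧ N = a * b := by
  rw [ZMod.isCyclic_units_iff] at hc
  push Not at hc
  obtain ⟨h0, h1, h2, h4, hp⟩ := hc
  rcases Nat.eq_two_pow_or_exists_odd_prime_and_dvd N with ⟨k, hk⟩ | ⟨p, hpp, hpN, hodd⟩
  · left
    rcases lt_or_ge k 3 with hk3 | hk3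
    · interval_cases k <;> simp_all
    · rw [hk]; exact pow_dvd_pow 2 hk3
  · right
    obtain ⟨k, b, hb, hNb⟩ := Nat.exists_eq_pow_mul_and_not_dvd h0 p hpp.ne_one
    have hk : k ≠ 0 := by rintro rfl; simp_all
    have hp2 : p ≠ 2 := by rintro rfl; revert hodd; decide
    have hp3 : 2 < p := lt_of_le_of_ne hpp.two_le hp2.symm
    refine ⟨p ^ k, b, ((Nat.Prime.coprime_iff_not_dvd hpp).2 hb).pow_left k,
      hp3.trans_le (Nat.le_self_pow hk p), ?_, hNb⟩
    have hp' := hp p k hpp (hpp.odd_of_ne_two hp2)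
    by_contra! hb2
    interval_cases b <;> simp_all [mul_comm]


/-- Let `N > 2` and let `e` be the exponent of `(ZMod N)ˣ`. The least positive
integer `f` such that `u ^ f = 1` or `u ^ f = -1` for every unit `u` of `ZMod N`
equals `e / 2` if `(ZMod N)ˣ` is cyclic, and equals `e` otherwise. -/
theorem stmt1 (N : ℕ) (hN : 2 < N) :
    (IsCyclic (ZMod N)ˣ →
      IsLeast {f : ℕ | 0 < f ∧ ∀ u : (ZMod N)ˣ, u ^ f = 1 ∨ u ^ f = -1}
        (Monoid.exponent (ZMod N)ˣ / 2)) ∧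
    (¬ IsCyclic (ZMod N)ˣ →
      IsLeast {f : ℕ | 0 < f ∧ ∀ u : (ZMod N)ˣ, u ^ f = 1 ∨ u ^ f = -1}
        (Monoid.exponent (ZMod N)ˣ)) := by
  have : NeZero N := ⟨by omega⟩
  have hpos : 0 < Monoid.exponent (ZMod N)ˣ :=
    Nat.pos_of_ne_zero Monoid.exponent_ne_zero_of_finite
  constructor
  · intro hc
    obtain ⟨k, hk⟩ := even_iff_two_dvd.1 (ZMod.even_exponent_units hN)
    rw [hk, Nat.mul_div_cancel_left k two_pos]
    refine ⟨⟨by omega, fun u ↦ ?_⟩, fun f hf ↦ ?_⟩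
    · by_cases hu : u ^ k = 1
      · exact Or.inl hu
      · refine Or.inr (IsCyclic.eq_of_sq_eq_one_of_ne_one ?_ hu (by simp)
          (ZMod.neg_one_ne_one_units hN))
        rw [← pow_mul, mul_comm, ← hk, Monoid.pow_exponent_eq_one]
    · have := exponent_le_two_mul_of_pow_eq_one_or_neg_one hf.1 hf.2
      omega
  · intro hc
    refine ⟨⟨hpos, fun u ↦ Or.inl (Monoid.pow_exponent_eq_one u)⟩, fun f hf ↦ ?_⟩
    refine Monoid.exponent_min' f hf.1 ?_
    rcases ZMod.eight_dvd_or_exists_coprime_mul_of_not_isCyclic_units hN hc with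
      h8 | ⟨a, b, hab, ha, hb, rfl⟩
    · exact ZMod.units_pow_eq_one_of_eight_dvd h8 hf.2
    · exact ZMod.units_pow_eq_one_of_coprime_mul hab ha hb hf.2
end

section
/- Let p be an odd prime and m = (p−1)/2. The m × m matrix H over ℤ/pℤ whose (i,j) entry (for 0-based indices 0 ≤ i, j ≤ m−1) is the inverse of (i+j+1) in ℤ/pℤ has nonzero determinant. -/
/-- A square Cauchy matrix over a field, with entries `(x i + y j)⁻¹` for injective `x` and `y`
and nonvanishing sums `x i + y j`, has nonzero determinant. -/
theorem Matrix.det_of_inv_add_ne_zero {ι K : Type*} [Fintype ι] [DecidableEq ι] [Field K]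
    {x y : ι → K} (hx : Function.Injective x) (hy : Function.Injective y)
    (hxy : ∀ i j, x i + y j ≠ 0) :
    (Matrix.of fun i j => (x i + y j)⁻¹).det ≠ 0 := by
  intro hdet
  obtain ⟨v, hv, hMv⟩ := Matrix.exists_mulVec_eq_zero_iff.mpr hdet
  refine hv (funext fun j => ?_)
  let z : ι → K := fun j => -y j
  have hz : Set.InjOn z (Finset.univ : Finset ι) := fun a _ b _ h => hy (neg_injective h)
  have hw (j : ι) : Lagrange.nodalWeight Finset.univ z j ≠ 0 :=
    Lagrange.nodalWeight_ne_zero hz (Finset.mem_univ j)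
  let r : ι → K := fun j => (Lagrange.nodalWeight Finset.univ z j)⁻¹ * v j
  have hzero : Lagrange.interpolate Finset.univ z r = 0 := by
    refine Polynomial.eq_zero_of_degree_lt_of_eval_index_eq_zero Finset.univ hx.injOn
      (Lagrange.degree_interpolate_lt r hz) fun i _ => ?_
    rw [Lagrange.eval_interpolate_not_at_node r fun j _ h =>
      hxy i j (by rw [h]; exact neg_add_cancel (y j))]
    refine mul_eq_zero_of_right _ (Eq.trans (Finset.sum_congr rfl fun j _ => ?_) (congrFun hMv i))
    change _ * (x i - -y j)⁻¹ * (_ * v j) = (x i + y j)⁻¹ * v j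
    rw [sub_neg_eq_add, mul_mul_mul_comm, mul_inv_cancel₀ (hw j), one_mul]
  have hr : r j = 0 := by
    rw [← Lagrange.eval_interpolate_at_node r hz (Finset.mem_univ j), hzero, Polynomial.eval_zero]
  exact (mul_eq_zero.mp hr).resolve_left (inv_ne_zero (hw j))

/-- For an odd prime `p` and `m = (p - 1) / 2`, the `m × m` matrix over `ZMod p`
with `(i, j)` entry `(i + j + 1)⁻¹` has nonzero determinant. -/
theorem stmt6 (p : ℕ) (hp : p.Prime) (hodd : Odd p) :
    (Matrix.of fun i j : Fin ((p - 1) / 2) =>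
        ((((i : ℕ) + (j : ℕ) + 1 : ℕ) : ZMod p))⁻¹).det ≠ 0 := by
  have : Fact p.Prime := ⟨hp⟩
  have hinj : Function.Injective fun i : Fin ((p - 1) / 2) => ((i : ℕ) : ZMod p) := by
    intro a b h
    have hmod := (ZMod.natCast_eq_natCast_iff' _ _ _).mp h
    rw [Nat.mod_eq_of_lt (by omega), Nat.mod_eq_of_lt (by omega)] at hmod
    exact Fin.ext hmod
  have hsum (i j : Fin ((p - 1) / 2)) : ((i : ℕ) : ZMod p) + (((j : ℕ) : ZMod p) + 1) ≠ 0 := by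
    intro h
    have hdvd : p ∣ (i : ℕ) + ((j : ℕ) + 1) := by
      rw [← ZMod.natCast_eq_zero_iff]
      exact_mod_cast h
    have := Nat.le_of_dvd (by omega) hdvd
    omega
  have hdet := Matrix.det_of_inv_add_ne_zero hinj ((add_left_injective 1).comp hinj) hsum
  simpa [add_assoc] using hdet
end

section
/- Let p be an odd prime and m = (p−1)/2. Let B be the m × m matrix over (ℤ/pℤ)[X] with (i,j) entry (0-based) (i+j+1)⁻¹ · ((X+1)^{i+j+1} − 1), let M(X) be the m × m matrix with (i,j) entry (i+j+1)⁻¹ · X^{i+j+1}, and let P be the m × m matrix with (i,j) entry the binomial coefficient C(j, i) (reduced mod p). Then B = Pᵀ · M(X) · P. -/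
open Polynomial Matrix

/-- In characteristic `p`, a polynomial of degree less than `p` is determined by its derivative
and its constant coefficient. -/
theorem Polynomial.eq_of_derivative_eq_of_natDegree_lt {K : Type*} [Field K] (p : ℕ) [CharP K p]
    {f g : K[X]} (hf : f.natDegree < p) (hg : g.natDegree < p)
    (h0 : f.coeff 0 = g.coeff 0) (h : derivative f = derivative g) : f = g := by
  ext n
  rcases n with _ | n
  · exact h0
  by_cases hn : n + 1 < p
  · have hc := congrArg (fun q => q.coeff n) h
    simp only [coeff_derivative] at hc
    have hne : ((n : K) + 1) ≠ 0 := by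
      rw [← Nat.cast_succ, Ne, CharP.cast_eq_zero_iff K p]
      exact Nat.not_dvd_of_pos_of_lt n.succ_pos hn
    exact mul_right_cancel₀ hne hc
  · rw [coeff_eq_zero_of_natDegree_lt (by omega), coeff_eq_zero_of_natDegree_lt (by omega)]

/-- If `n + 1` is invertible, then `(n + 1)⁻¹ * q ^ (n + 1)` is an antiderivative of
`q ^ n * derivative q`. -/
theorem Polynomial.derivative_C_inv_mul_pow_succ {K : Type*} [Field K] {n : ℕ}
    (hn : ((n + 1 : ℕ) : K) ≠ 0) (q : K[X]) :
    derivative (C (((n + 1 : ℕ) : K)⁻¹) * q ^ (n + 1)) = q ^ n * derivative q := by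
  rw [derivative_C_mul, derivative_pow_succ, ← Nat.cast_succ, Nat.succ_eq_add_one,
    ← mul_assoc, ← mul_assoc, ← C_mul, inv_mul_cancel₀ hn, C_1, one_mul]

/-- The binomial theorem, with the sum running over any `Fin m` with `n < m`. -/
theorem Polynomial.sum_fin_choose_mul_X_pow {R : Type*} [CommSemiring R] {m n : ℕ} (hn : n < m) :
    ∑ k : Fin m, C ((n.choose k : R)) * X ^ (k : ℕ) = (X + 1 : R[X]) ^ n := by
  rw [Fin.sum_univ_eq_sum_range (fun k => C ((n.choose k : R)) * X ^ k) m, add_pow]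
  symm
  refine Finset.sum_subset_zero_on_sdiff (Finset.range_subset_range.2 hn) ?_ ?_
  · intro k hk
    simp only [Finset.mem_sdiff, Finset.mem_range] at hk
    rw [Nat.choose_eq_zero_of_lt (by omega)]
    simp
  · intro k _
    simp [mul_comm]

/-- For an odd prime `p` and `m = (p - 1) / 2`: the matrix `B` with `(i, j)` entry
`(i + j + 1)⁻¹ * ((X + 1) ^ (i + j + 1) - 1)` factors as `Pᵀ * M(X) * P`, where `M(X)`
has entries `(i + j + 1)⁻¹ * X ^ (i + j + 1)` and `P` is the Pascal matrix with
`(i, j)` entry the binomial coefficient `C(j, i)` reduced mod `p`. -/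
theorem stmt8 (p : ℕ) (hp : p.Prime) (hodd : Odd p) :
    (Matrix.of fun i j : Fin ((p - 1) / 2) =>
        C (((((i : ℕ) + (j : ℕ) + 1 : ℕ)) : ZMod p)⁻¹) *
          (((X : (ZMod p)[X]) + 1) ^ ((i : ℕ) + (j : ℕ) + 1) - 1)) =
      (Matrix.of fun i j : Fin ((p - 1) / 2) =>
          (C ((Nat.choose (j : ℕ) (i : ℕ) : ZMod p)) : (ZMod p)[X]))ᵀ *
        (Matrix.of fun i j : Fin ((p - 1) / 2) =>
          C (((((i : ℕ) + (j : ℕ) + 1 : ℕ)) : ZMod p)⁻¹) *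
            (X : (ZMod p)[X]) ^ ((i : ℕ) + (j : ℕ) + 1)) *
        (Matrix.of fun i j : Fin ((p - 1) / 2) =>
          (C ((Nat.choose (j : ℕ) (i : ℕ) : ZMod p)) : (ZMod p)[X])) := by
  have : Fact p.Prime := ⟨hp⟩
  have hp2 := hp.two_le
  have hne : ∀ i j : Fin ((p - 1) / 2), (((i : ℕ) + (j : ℕ) + 1 : ℕ) : ZMod p) ≠ 0 := fun i j => by
    rw [Ne, CharP.cast_eq_zero_iff (ZMod p) p]
    exact Nat.not_dvd_of_pos_of_lt (Nat.succ_pos _) (by omega)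
  ext1 i j
  simp only [Matrix.mul_apply, Matrix.transpose_apply, Matrix.of_apply, Finset.sum_mul]
  refine eq_of_derivative_eq_of_natDegree_lt p ?_ ?_ ?_ ?_
  · refine lt_of_le_of_lt (b := (i : ℕ) + j + 1) ?_ (by omega)
    compute_degree
  · refine lt_of_le_of_lt (b := p - 1) ?_ (by omega)
    refine natDegree_sum_le_of_forall_le _ _ fun l _ =>
      natDegree_sum_le_of_forall_le _ _ fun k _ => ?_
    refine (natDegree_mul_C_le _ _).trans <| (natDegree_C_mul_le _ _).trans <|
      (natDegree_C_mul_X_pow_le _ _).trans (by omega)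
  · simp [coeff_zero_eq_eval_zero, eval_finsetSum]
  · rw [mul_sub, mul_one, derivative_sub, derivative_C_inv_mul_pow_succ (hne i j), derivative_C]
    simp only [derivative_sum]
    rw [pow_add, ← sum_fin_choose_mul_X_pow i.isLt, ← sum_fin_choose_mul_X_pow j.isLt,
      Finset.sum_mul_sum, Finset.sum_comm]
    simp only [derivative_add, derivative_X, derivative_one, add_zero, mul_one, sub_zero]
    refine Finset.sum_congr rfl fun l _ => Finset.sum_congr rfl fun k _ => ?_
    rw [mul_comm _ (C _), derivative_C_mul, derivative_C_mul,
      derivative_C_inv_mul_pow_succ (hne k l), derivative_X]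
    ring
end

section
/- Let p be an odd prime and m = (p−1)/2. Let B be the m × m matrix over (ℤ/pℤ)[X] with (i,j) entry (0-based) (i+j+1)⁻¹ · ((X+1)^{i+j+1} − 1). Then det B = X^{m²} · det H, where H is the m × m matrix over ℤ/pℤ with (i,j) entry (i+j+1)⁻¹; in particular det B = c · X^{m²} for a nonzero constant c ∈ ℤ/pℤ. -/
open Polynomial

namespace Polynomial

variable {K : Type*} [Field K]

/-- The formal antiderivative with zero constant term, as a linear map. The coefficient
`(k + 1)⁻¹` is zero when `k + 1` vanishes in `K`. -/
noncomputable def formalIntegral : K[X] →ₗ[K] K[X] :=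
  lsum fun k => ((k : K) + 1)⁻¹ • monomial (k + 1)

lemma formalIntegral_X_pow (k : ℕ) :
    formalIntegral (X ^ k : K[X]) = C ((k : K) + 1)⁻¹ * X ^ (k + 1) := by
  rw [formalIntegral, lsum_apply, ← monomial_one_right_eq_X_pow, sum_monomial_index _ _ (by simp)]
  simp [smul_monomial, C_mul_X_pow_eq_monomial]

lemma formalIntegral_X_add_one_pow {n : ℕ} (hn : ∀ k ≤ n, (k : K) + 1 ≠ 0) :
    formalIntegral ((X + 1) ^ n : K[X]) = C ((n : K) + 1)⁻¹ * ((X + 1) ^ (n + 1) - 1) := by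
  have key : ((X : K[X]) + 1) ^ (n + 1) - 1 =
      ∑ k ∈ Finset.range (n + 1), X ^ (k + 1) * ((n + 1).choose (k + 1) : K[X]) := by
    rw [add_pow, Finset.sum_range_succ']
    simp
  rw [key, add_pow, map_sum, Finset.mul_sum]
  refine Finset.sum_congr rfl fun k hk => ?_
  have hk' := hn k (Nat.lt_succ_iff.mp (Finset.mem_range.mp hk))
  have hn' := hn n le_rfl
  have hchoose : ((n : K) + 1) * (n.choose k : K) =
      ((n + 1).choose (k + 1) : K) * ((k : K) + 1) := by
    exact_mod_cast congrArg (Nat.cast : ℕ → K) (Nat.add_one_mul_choose_eq n k)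
  have hcoeff : (n.choose k : K) * ((k : K) + 1)⁻¹ =
      ((n : K) + 1)⁻¹ * ((n + 1).choose (k + 1) : K) := by
    field_simp
    linear_combination hchoose
  rw [one_pow, mul_one, mul_comm, ← C_eq_natCast, ← smul_eq_C_mul, map_smul, formalIntegral_X_pow,
    smul_eq_C_mul, ← mul_assoc, ← C_mul, hcoeff, C_mul, ← C_eq_natCast]
  ring

end Polynomial

namespace Matrix

variable {K : Type*} [Field K]

lemma det_choose (R : Type*) [CommRing R] (n : ℕ) :
    (of fun i j : Fin n => ((i : ℕ).choose j : R)).det = 1 := by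
  rw [det_of_isLowerTriangular]
  · simp
  · intro i j hij
    have hij' : (i : ℕ) < j := by simpa using hij
    simp [Nat.choose_eq_zero_of_lt hij']

lemma det_hankel_X_add_one_pow {n : ℕ} (hn : ∀ k, k + 1 < 2 * n → (k : K) + 1 ≠ 0) :
    (of fun i j : Fin n =>
        C (((i : ℕ) + (j : ℕ) + 1 : ℕ) : K)⁻¹ *
          (((X : K[X]) + 1) ^ ((i : ℕ) + (j : ℕ) + 1) - 1)).det =
      X ^ (n ^ 2) * C (of fun i j : Fin n => (((i : ℕ) + (j : ℕ) + 1 : ℕ) : K)⁻¹).det := by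
  set H : Matrix (Fin n) (Fin n) K := of fun i j => (((i : ℕ) + (j : ℕ) + 1 : ℕ) : K)⁻¹ with hH
  set L : Matrix (Fin n) (Fin n) K[X] := of fun i j => ((i : ℕ).choose j : K[X]) with hL
  have hpow (i : Fin n) :
      ((X : K[X]) + 1) ^ (i : ℕ) = ∑ a : Fin n, ((i : ℕ).choose a : K) • X ^ (a : ℕ) := by
    rw [Fin.sum_univ_eq_sum_range (fun a => ((i : ℕ).choose a : K) • (X : K[X]) ^ a), add_pow]
    refine Finset.sum_subset_zero_on_sdiff ?_ ?_ ?_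
    · exact Finset.range_subset_range.mpr i.isLt
    · intro a ha
      simp only [Finset.mem_sdiff, Finset.mem_range, not_lt] at ha
      simp [Nat.choose_eq_zero_of_lt ha.2]
    · intro a _
      simp [smul_eq_C_mul, mul_comm]
  have hfactor : (of fun i j : Fin n =>
        C (((i : ℕ) + (j : ℕ) + 1 : ℕ) : K)⁻¹ *
          (((X : K[X]) + 1) ^ ((i : ℕ) + (j : ℕ) + 1) - 1)) =
      L * (diagonal (fun i : Fin n => (X : K[X]) ^ (i : ℕ)) * H.map C *
        diagonal (fun i : Fin n => (X : K[X]) ^ ((i : ℕ) + 1))) * Lᵀ := by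
    ext1 i j
    have hint := formalIntegral_X_add_one_pow (K := K) (n := (i : ℕ) + j)
      fun k hk => hn k (by omega)
    rw [of_apply]
    push_cast at hint ⊢
    rw [← hint, pow_add, hpow i, hpow j, Finset.sum_mul_sum, map_sum, mul_assoc, mul_apply]
    refine Finset.sum_congr rfl fun a _ => ?_
    rw [map_sum, mul_apply, Finset.mul_sum]
    refine Finset.sum_congr rfl fun b _ => ?_
    rw [smul_mul_smul_comm, ← pow_add, map_smul, formalIntegral_X_pow, mul_diagonal, diagonal_mul]
    simp only [hL, hH, of_apply, map_apply, transpose_apply, smul_eq_C_mul, C_mul, map_natCast]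
    push_cast
    ring
  have hmap : (H.map C).det = C H.det := (RingHom.map_det C H).symm
  have hexp : (∑ i : Fin n, (i : ℕ)) + ∑ i : Fin n, ((i : ℕ) + 1) = n ^ 2 := by
    rw [Fin.sum_univ_eq_sum_range (fun i => i), Fin.sum_univ_eq_sum_range (fun i => i + 1),
      Finset.sum_add_distrib]
    have := Finset.sum_range_id_mul_two n
    cases n with
    | zero => simp
    | succ n => simp at this ⊢; nlinarith
  rw [hfactor, det_mul, det_mul, det_transpose, det_choose, det_mul, det_mul, det_diagonal,
    det_diagonal, hmap, Finset.prod_pow_eq_pow_sum, Finset.prod_pow_eq_pow_sum, ← hexp, pow_add]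
  ring

lemma det_cauchy_ne_zero {ι : Type*} [Fintype ι] [DecidableEq ι] {x y : ι → K}
    (hx : Function.Injective x) (hy : Function.Injective y) (hxy : ∀ i j, x i + y j ≠ 0) :
    (of fun i j => (x i + y j)⁻¹).det ≠ 0 := by
  intro hdet
  obtain ⟨v, hv, hMv⟩ := exists_mulVec_eq_zero_iff.mpr hdet
  let Q : K[X] := ∑ j, C (v j) * ∏ k ∈ Finset.univ.erase j, (X + C (y k))
  have hdeg : Q.degree < (Finset.univ : Finset ι).card := by
    refine (degree_sum_le _ _).trans_lt ((Finset.sup_lt_iff (WithBot.bot_lt_coe _)).mpr ?_)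
    intro j _
    have hcard : (Finset.univ.erase j).card < (Finset.univ : Finset ι).card :=
      Finset.card_erase_lt_of_mem (Finset.mem_univ j)
    calc
      _ ≤ (∏ k ∈ Finset.univ.erase j, (X + C (y k))).degree := by
        rw [← smul_eq_C_mul]
        exact degree_smul_le _ _
      _ = ((Finset.univ.erase j).card : WithBot ℕ) := by simp [degree_prod]
      _ < _ := by exact_mod_cast hcard
  have hQ : Q = 0 := by
    refine eq_zero_of_degree_lt_of_eval_index_eq_zero _ hx.injOn hdeg fun i _ => ?_
    have hrow : ∑ j, (x i + y j)⁻¹ * v j = 0 := congrFun hMv i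
    have heval : Q.eval (x i) = (∏ k, (x i + y k)) * ∑ j, (x i + y j)⁻¹ * v j := by
      simp only [Q, eval_finsetSum, eval_mul, eval_C, eval_prod, eval_add, eval_X, Finset.mul_sum]
      refine Finset.sum_congr rfl fun j _ => ?_
      rw [← Finset.mul_prod_erase _ _ (Finset.mem_univ j)]
      field_simp [hxy i j]
    rw [heval, hrow, mul_zero]
  refine hv (funext fun j => ?_)
  have heval : Q.eval (-y j) = v j * ∏ k ∈ Finset.univ.erase j, (-y j + y k) := by
    simp only [Q, eval_finsetSum, eval_mul, eval_C, eval_prod, eval_add, eval_X]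
    refine Finset.sum_eq_single j (fun l _ hl => ?_) (by simp)
    rw [Finset.prod_eq_zero (Finset.mem_erase.mpr ⟨hl.symm, Finset.mem_univ j⟩) (by simp), mul_zero]
  rw [hQ, eval_zero] at heval
  refine (mul_eq_zero.mp heval.symm).resolve_right (Finset.prod_ne_zero_iff.mpr fun k hk h => ?_)
  exact (Finset.mem_erase.mp hk).1 (hy (by linear_combination h))

end Matrix

/-- For an odd prime `p` and `m = (p - 1) / 2`: the determinant of the matrix `B` with
`(i, j)` entry `(i + j + 1)⁻¹ * ((X + 1) ^ (i + j + 1) - 1)` equals `X ^ (m ^ 2)` times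
the determinant of `H` (entries `(i + j + 1)⁻¹` over `ZMod p`); in particular it equals
`c * X ^ (m ^ 2)` for a nonzero constant `c`. -/
theorem stmt10 (p : ℕ) (hp : p.Prime) (hodd : Odd p) :
    (Matrix.of fun i j : Fin ((p - 1) / 2) =>
        C (((((i : ℕ) + (j : ℕ) + 1 : ℕ)) : ZMod p)⁻¹) *
          (((X : (ZMod p)[X]) + 1) ^ ((i : ℕ) + (j : ℕ) + 1) - 1)).det =
      (X : (ZMod p)[X]) ^ (((p - 1) / 2) ^ 2) *
        C ((Matrix.of fun i j : Fin ((p - 1) / 2) =>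
            ((((i : ℕ) + (j : ℕ) + 1 : ℕ) : ZMod p))⁻¹).det) ∧
    ∃ c : ZMod p, c ≠ 0 ∧
      (Matrix.of fun i j : Fin ((p - 1) / 2) =>
          C (((((i : ℕ) + (j : ℕ) + 1 : ℕ)) : ZMod p)⁻¹) *
            (((X : (ZMod p)[X]) + 1) ^ ((i : ℕ) + (j : ℕ) + 1) - 1)).det =
        C c * (X : (ZMod p)[X]) ^ (((p - 1) / 2) ^ 2) := by
  have : Fact p.Prime := ⟨hp⟩
  have hne (k : ℕ) (hk : k + 1 < p) : (k : ZMod p) + 1 ≠ 0 := by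
    have hndvd := Nat.not_dvd_of_pos_of_lt k.succ_pos hk
    rw [← ZMod.natCast_eq_zero_iff] at hndvd
    exact_mod_cast hndvd
  have hdet := Matrix.det_hankel_X_add_one_pow (K := ZMod p) (n := (p - 1) / 2)
    fun k hk => hne k (by omega)
  have hinj : Function.Injective fun i : Fin ((p - 1) / 2) => ((i : ℕ) : ZMod p) := by
    intro i j hij
    refine Fin.ext (Nat.ModEq.eq_of_lt_of_lt ((ZMod.natCast_eq_natCast_iff _ _ p).mp hij) ?_ ?_) <;>
      omega
  have hH := Matrix.det_cauchy_ne_zero (y := fun j : Fin ((p - 1) / 2) => ((j : ℕ) : ZMod p) + 1)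
    hinj (fun i j hij => hinj (add_right_cancel hij)) fun i j => by
      have := hne (i + j) (by omega)
      push_cast at this
      rwa [← add_assoc]
  refine ⟨hdet, _, ?_, hdet.trans (mul_comm _ _)⟩
  convert hH using 5
  push_cast
  ring
end

section
/- Let p be an odd prime and m = (p−1)/2. Let A be the m × m matrix over (ℤ/pℤ)[X] with (i,j) entry (0-based) (i+j+1)⁻¹ · (X^{i+j+1} − X^{p}). Then X^{m²} divides det A in (ℤ/pℤ)[X]. -/
open Polynomial

/-- If the `(i, j)` entry of an `m × m` matrix is divisible by `x ^ (i + j + 1)`, then its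
determinant is divisible by `x ^ (m ^ 2)`. -/
theorem Matrix.pow_sq_dvd_det {R : Type*} [CommRing R] {m : ℕ} (x : R)
    (M : Matrix (Fin m) (Fin m) R) (h : ∀ i j : Fin m, x ^ ((i : ℕ) + (j : ℕ) + 1) ∣ M i j) :
    x ^ (m ^ 2) ∣ M.det := by
  rw [Matrix.det_apply]
  refine Finset.dvd_sum fun σ _ => ?_
  have hsum : ∑ i : Fin m, ((σ i : ℕ) + (i : ℕ) + 1) = m ^ 2 := by
    have hσ : ∑ i : Fin m, (σ i : ℕ) = ∑ i : Fin m, (i : ℕ) :=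
      Equiv.sum_comp σ fun i : Fin m => (i : ℕ)
    have hid : (∑ i ∈ Finset.range m, i) * 2 = m * (m - 1) := Finset.sum_range_id_mul_two m
    simp only [Finset.sum_add_distrib, hσ, Fin.sum_univ_eq_sum_range (fun i => i) m]
    cases m with
    | zero => simp
    | succ k =>
      simp only [Nat.add_sub_cancel] at hid
      simp only [Finset.sum_const, Finset.card_univ, Fintype.card_fin, smul_eq_mul, mul_one]
      linarith [sq (k + 1)]
  have hprod : x ^ (m ^ 2) ∣ ∏ i, M (σ i) i := by
    rw [← hsum, ← Finset.prod_pow_eq_pow_sum]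
    exact Finset.prod_dvd_prod_of_dvd _ _ fun i _ => h (σ i) i
  rw [Units.smul_def, zsmul_eq_mul]
  exact hprod.mul_left _

/-- For an odd prime `p` and `m = (p - 1) / 2`: `X ^ (m ^ 2)` divides the determinant of
the `m × m` matrix `A` over `(ZMod p)[X]` with `(i, j)` entry
`(i + j + 1)⁻¹ * (X ^ (i + j + 1) - X ^ p)`. -/
theorem stmt11 (p : ℕ) (hp : p.Prime) (hodd : Odd p) :
    (X : (ZMod p)[X]) ^ (((p - 1) / 2) ^ 2) ∣
      (Matrix.of fun i j : Fin ((p - 1) / 2) =>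
          C (((((i : ℕ) + (j : ℕ) + 1 : ℕ)) : ZMod p)⁻¹) *
            ((X : (ZMod p)[X]) ^ ((i : ℕ) + (j : ℕ) + 1) - (X : (ZMod p)[X]) ^ p)).det := by
  refine Matrix.pow_sq_dvd_det _ _ fun i j => ?_
  have hij : (i : ℕ) + (j : ℕ) + 1 ≤ p := by omega
  exact (dvd_sub dvd_rfl (pow_dvd_pow _ hij)).mul_left _
end

section
/- Let p be an odd prime and m = (p−1)/2. Let A be the m × m matrix over (ℤ/pℤ)[X] with (i,j) entry (0-based) (i+j+1)⁻¹ · (X^{i+j+1} − X^{p}), and let H_p(X) = Σ_{k=0}^{m} C(m,k)² · X^{k} ∈ (ℤ/pℤ)[X] be the Hasse polynomial, where C(m,k) is the binomial coefficient reduced mod p. Then there exists a nonzero constant c ∈ ℤ/pℤ such that det A = c · X^{m²} · (1 − X)^{m²} · H_p(X). -/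
open Polynomial

/-- Hankel determinants of the moments of a linear functional are invariant under translation. -/
theorem det_hankel_X_add_C {R : Type*} [CommRing R] (φ : R[X] →ₗ[R] R) (x : R) (m : ℕ) :
    (Matrix.of fun k l : Fin m => φ ((X + C x) ^ ((k : ℕ) + l))).det =
      (Matrix.of fun k l : Fin m => φ (X ^ ((k : ℕ) + l))).det := by
  set S : Matrix (Fin m) (Fin m) R :=
    Matrix.of fun k a => ((X + C x : R[X]) ^ (k : ℕ)).coeff a with hS
  have hdet : S.det = 1 := by
    rw [Matrix.det_of_isLowerTriangular]
    · simp [hS, coeff_X_add_C_pow]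
    · intro i j hij
      have : (i : ℕ) < j := hij
      simp [hS, coeff_X_add_C_pow, Nat.choose_eq_zero_of_lt this]
  have hX : (X + C x : R[X]).natDegree ≤ 1 := natDegree_add_C.trans_le natDegree_X_le
  have hexp (k : Fin m) : (X + C x : R[X]) ^ (k : ℕ) = ∑ a : Fin m, C (S k a) * X ^ (a : ℕ) := by
    refine Eq.trans ?_ (Fin.sum_univ_eq_sum_range
      (fun a => C (((X + C x : R[X]) ^ (k : ℕ)).coeff a) * X ^ a) m).symm
    refine as_sum_range_C_mul_X_pow' _ (lt_of_le_of_lt ?_ k.2)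
    refine natDegree_pow_le.trans ?_
    simpa using Nat.mul_le_mul_left (k : ℕ) hX
  have hfac : (Matrix.of fun k l : Fin m => φ ((X + C x) ^ ((k : ℕ) + l))) =
      S * (Matrix.of fun k l : Fin m => φ (X ^ ((k : ℕ) + l))) * S.transpose := by
    ext k l
    have : (X + C x : R[X]) ^ ((k : ℕ) + l) =
        ∑ b, ∑ a, (S k a * S l b) • (X : R[X]) ^ ((a : ℕ) + b) := by
      rw [pow_add, hexp k, hexp l, Finset.sum_mul_sum, Finset.sum_comm]
      refine Finset.sum_congr rfl fun b _ => Finset.sum_congr rfl fun a _ => ?_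
      rw [smul_eq_C_mul, C_mul]
      ring
    simp only [Matrix.of_apply, this, map_sum, map_smul, Matrix.mul_apply, Matrix.transpose_apply,
      Finset.sum_mul, smul_eq_mul]
    refine Finset.sum_congr rfl fun b _ => Finset.sum_congr rfl fun a _ => ?_
    ring
  rw [hfac, Matrix.det_mul, Matrix.det_mul, Matrix.det_transpose, hdet, one_mul, mul_one]

/-- The Christoffel formula: if `∑ c l * T ^ l` is orthogonal to all polynomials of degree less
than `m` for the functional with moments `h`, its value at `x` is given by the Hankel determinant of
the functional multiplied by `T - x`. -/
theorem det_hankel_christoffel {R : Type*} [CommRing R] (m : ℕ) (h c : ℕ → R) (x : R)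
    (hc : ∀ k < m, ∑ l ∈ Finset.range (m + 1), c l * h (k + l) = 0) :
    c m * (Matrix.of fun k l : Fin m => h ((k : ℕ) + l + 1) - x * h ((k : ℕ) + l)).det =
      (-1) ^ m * (∑ l ∈ Finset.range (m + 1), c l * x ^ l) *
        (Matrix.of fun k l : Fin m => h ((k : ℕ) + l)).det := by
  set W : Matrix (Fin (m + 1)) (Fin (m + 1)) R :=
    Matrix.of (Fin.cons (fun l => x ^ (l : ℕ)) fun k l => h ((k : ℕ) + l)) with hW
  have hW0 (l : Fin (m + 1)) : W 0 l = x ^ (l : ℕ) := rfl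
  have hWs (k : Fin m) (l : Fin (m + 1)) : W k.succ l = h ((k : ℕ) + l) := rfl
  have h1 : W.det =
      (Matrix.of fun k l : Fin m => h ((k : ℕ) + l + 1) - x * h ((k : ℕ) + l)).det := by
    set V : Matrix (Fin (m + 1)) (Fin (m + 1)) R :=
      Matrix.of fun i => Fin.cons (W i 0) fun j => W i j.succ - x * W i j.castSucc with hV
    rw [Matrix.det_eq_of_forall_col_eq_smul_add_pred (A := W) (B := V) (fun _ => x)
      (fun i => by simp [hV]) (fun i j => by simp [hV]), Matrix.det_succ_row_zero,
      Fin.sum_univ_succ, Finset.sum_eq_zero]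
    · have : V.submatrix Fin.succ (Fin.succAbove 0) =
          Matrix.of fun k l : Fin m => h ((k : ℕ) + l + 1) - x * h ((k : ℕ) + l) := by
        ext k l
        simp [hV, hWs, add_assoc]
      rw [this]
      simp [hV, hW0]
    · intro j _
      simp [hV, hW0, pow_succ, mul_comm]
  have h2 := Matrix.det_updateCol_sum W (Fin.last m) fun i => c i
  rw [Matrix.det_succ_column _ (Fin.last m), Fin.sum_univ_succ, Finset.sum_eq_zero, h1] at h2
  · rw [smul_eq_mul, Fin.val_last] at h2
    rw [← h2]
    have : (W.updateCol (Fin.last m) fun k => ∑ i : Fin (m + 1), c i • W k i).submatrix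
        (Fin.succAbove 0) (Fin.last m).succAbove = Matrix.of fun k l : Fin m => h ((k : ℕ) + l) := by
      ext k l
      simp [hWs, (Fin.castSucc_lt_last l).ne]
    rw [this]
    simp [hW0, Finset.sum_range]
  · intro k _
    have := hc k k.2
    rw [Finset.sum_range] at this
    simp [hWs, this]

/-- Scaling the `(i, j)` entry of an `m × m` matrix by `y ^ (i + j + 1)` scales its determinant by
`y ^ m²`. -/
theorem det_pow_scale {R : Type*} [CommRing R] (m : ℕ) (y : R) (B : Matrix (Fin m) (Fin m) R) :
    (Matrix.of fun i j : Fin m => y ^ ((i : ℕ) + j + 1) * B i j).det = y ^ (m ^ 2) * B.det := by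
  have hsum (n : ℕ) : ∑ i ∈ Finset.range n, (2 * i + 1) = n ^ 2 := by
    induction n with
    | zero => simp
    | succ n ih => rw [Finset.sum_range_succ, ih]; ring
  have hB : (Matrix.of fun i j : Fin m => y ^ ((i : ℕ) + j + 1) * B i j) =
      Matrix.of fun i j : Fin m => y ^ ((i : ℕ) + 1) *
        (Matrix.of fun i j : Fin m => y ^ (j : ℕ) * B i j) i j := by
    ext i j
    simp only [Matrix.of_apply]
    ring
  rw [hB, Matrix.det_mul_column, Matrix.det_mul_row, ← mul_assoc, ← Finset.prod_mul_distrib,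
    ← hsum, ← Fin.sum_univ_eq_sum_range (fun i => 2 * i + 1), ← Finset.prod_pow_eq_pow_sum]
  congr 1
  refine Finset.prod_congr rfl fun i _ => ?_
  ring

/-- Orthogonality of the shifted Legendre polynomial to polynomials of lower degree. -/
theorem sum_legendre_mul_inv_eq_zero {K : Type*} [Field K] (m : ℕ)
    (hK : ∀ n : ℕ, 0 < n → n ≤ 2 * m → (n : K) ≠ 0) (k : ℕ) (hk : k < m) :
    ∑ l ∈ Finset.range (m + 1),
      ((-1) ^ l * (m.choose l : K) * ((m + l).choose l : K)) * ((k + l + 1 : ℕ) : K)⁻¹ = 0 := by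
  set P : K[X] := ∏ i ∈ (Finset.range m).erase k, (X + C ((i + 1 : ℕ) : K)) with hP
  have hdeg : P.natDegree < m := by
    rw [hP, natDegree_prod_of_monic _ _ fun i _ => monic_X_add_C _]
    simp only [natDegree_X_add_C, Finset.sum_const, smul_eq_mul, mul_one]
    rw [Finset.card_erase_of_mem (by simpa using hk), Finset.card_range]
    omega
  have hev (l : ℕ) (hl : l ≤ m) :
      P.eval (l : K) = (m.factorial : K) * ((m + l).choose l : K) * ((k + l + 1 : ℕ) : K)⁻¹ := by
    have hne : ((k + l + 1 : ℕ) : K) ≠ 0 := hK _ (by omega) (by omega)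
    rw [eq_mul_inv_iff_mul_eq₀ hne, hP, eval_prod]
    have : ((k + l + 1 : ℕ) : K) = eval (l : K) (X + C ((k + 1 : ℕ) : K)) := by
      simp; ring
    rw [this, Finset.prod_erase_mul _ _ (by simpa using hk)]
    have h2 := Nat.ascFactorial_eq_factorial_mul_choose l m
    rw [Nat.ascFactorial_eq_prod_range, add_comm l m, Nat.choose_symm_add] at h2
    rw [← Nat.cast_mul, ← h2, Nat.cast_prod]
    refine Finset.prod_congr rfl fun i _ => ?_
    simp; ring
  have h0 := congrFun (fwdDiff_iter_eq_zero_of_degree_lt hdeg) 0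
  rw [fwdDiff_iter_eq_sum_shift] at h0
  have hfac : (m.factorial : K) ≠ 0 := by
    rw [← Finset.prod_range_add_one_eq_factorial, Nat.cast_prod, Finset.prod_ne_zero_iff]
    intro i hi
    rw [Finset.mem_range] at hi
    exact hK _ (by omega) (by omega)
  refine (mul_eq_zero.1 (?_ : ((-1) ^ m * (m.factorial : K)) * _ = 0)).resolve_left
    (mul_ne_zero (pow_ne_zero _ (by simp)) hfac)
  rw [Finset.mul_sum]
  refine Eq.trans (Finset.sum_congr rfl fun l hl => ?_) h0
  have hl' : l ≤ m := by simpa [Nat.lt_succ_iff] using hl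
  have hsign : ((-1 : K)) ^ m * (-1) ^ l = (-1) ^ (m - l) := by
    obtain ⟨d, rfl⟩ := Nat.exists_eq_add_of_le hl'
    rw [Nat.add_sub_cancel_left, pow_add, mul_right_comm, ← pow_add, ← two_mul, pow_mul]
    simp
  rw [zero_add, nsmul_one, hev l hl', zsmul_eq_mul]
  push_cast
  rw [← hsign]
  ring

/-- Invertibility of the Hilbert matrix over a field of large enough characteristic. -/
theorem det_hilbert_ne_zero {K : Type*} [Field K] (m : ℕ)
    (hK : ∀ n : ℕ, 0 < n → n ≤ 2 * m → (n : K) ≠ 0) :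
    (Matrix.of fun i j : Fin m => (((i : ℕ) + j + 1 : ℕ) : K)⁻¹).det ≠ 0 := by
  have hinj {a b : ℕ} (ha : a < m) (hb : b < m) (hab : (a : K) = b) : a = b := by
    wlog hle : a ≤ b generalizing a b
    · exact (this hb ha hab.symm (by omega)).symm
    by_contra hne
    refine hK (b - a) (by omega) (by omega) ?_
    rw [Nat.cast_sub hle, hab, sub_self]
  intro h0
  obtain ⟨v, hv, hv0⟩ := Matrix.exists_mulVec_eq_zero_iff.2 h0
  set Q : K[X] := ∑ j : Fin m, C (v j) *
    ∏ l ∈ Finset.univ.erase j, (X + C (((l : ℕ) + 1 : ℕ) : K)) with hQ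
  have hQ0 : Q = 0 := by
    refine eq_zero_of_natDegree_lt_card_of_eval_eq_zero Q (ι := Fin m)
      (f := fun i => ((i : ℕ) : K)) (fun a b hab => Fin.ext (hinj a.2 b.2 hab)) ?_ ?_
    · intro i
      have hi := congrFun hv0 i
      simp only [Matrix.mulVec, dotProduct, Matrix.of_apply, Pi.zero_apply] at hi
      rw [hQ, eval_finsetSum]
      rw [← mul_zero (∏ l : Fin m, eval ((i : ℕ) : K) (X + C (((l : ℕ) + 1 : ℕ) : K))), ← hi,
        Finset.mul_sum]
      refine Finset.sum_congr rfl fun j _ => ?_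
      have hne : (((i : ℕ) + j + 1 : ℕ) : K) ≠ 0 := hK _ (by omega) (by omega)
      have he : eval ((i : ℕ) : K) (X + C (((j : ℕ) + 1 : ℕ) : K)) =
          (((i : ℕ) + j + 1 : ℕ) : K) := by
        simp; ring
      rw [← Finset.prod_erase_mul _ _ (Finset.mem_univ j), he, eval_mul, eval_C, eval_prod,
        mul_assoc, mul_inv_cancel_left₀ hne, mul_comm]
    · rw [Fintype.card_fin]
      have hm : 0 < m := by
        rcases Nat.eq_zero_or_pos m with rfl | h
        · exact absurd (Subsingleton.elim v 0) hv
        · exact h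
      refine lt_of_le_of_lt (natDegree_sum_le_of_forall_le (n := m - 1) _ _ fun j _ => ?_)
        (by omega)
      refine (natDegree_C_mul_le _ _).trans ?_
      rw [natDegree_prod_of_monic _ _ fun i _ => monic_X_add_C _]
      simp only [natDegree_X_add_C, Finset.sum_const, smul_eq_mul, mul_one]
      rw [Finset.card_erase_of_mem (Finset.mem_univ j), Finset.card_univ, Fintype.card_fin]
  refine hv (funext fun j => ?_)
  have hj := congrArg (eval (-(((j : ℕ) + 1 : ℕ) : K))) hQ0
  rw [hQ, eval_finsetSum, Finset.sum_eq_single j, eval_mul, eval_C, eval_prod, eval_zero] at hj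
  · refine (mul_eq_zero.1 hj).resolve_right (Finset.prod_ne_zero_iff.2 fun l hl h => ?_)
    refine Finset.ne_of_mem_erase hl (Fin.ext (hinj l.2 j.2 ?_))
    simp only [eval_add, eval_X, eval_C, Nat.cast_add, Nat.cast_one] at h
    linear_combination h
  · intro b _ hb
    rw [eval_mul, eval_prod, Finset.prod_eq_zero (i := j), mul_zero]
    · simpa using hb.symm
    · simp
  · simp

/-- The shifted Legendre polynomial in Bernstein form equals the Hasse polynomial. -/
theorem sum_choose_mul_choose_eq_hasse {R : Type*} [CommRing R] (m : ℕ) (x : R) :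
    ∑ l ∈ Finset.range (m + 1),
      (m.choose l : R) * ((m + l).choose l : R) * (1 - x) ^ (m - l) * x ^ l =
    ∑ k ∈ Finset.range (m + 1), (m.choose k : R) ^ 2 * x ^ k := by
  have key : ((1 + X : R[X]) ^ m * (C x * (1 + X) + C (1 - x)) ^ m) =
      (1 + X) ^ m * (1 + C x * X) ^ m := by
    rw [C_sub, C_1]
    ring
  have hc := congrArg (fun q => coeff q m) key
  rw [add_pow (C x * (1 + X)), Finset.mul_sum, finsetSum_coeff] at hc
  rw [add_comm (1 : R[X]) (C x * X), add_pow (C x * X), Finset.mul_sum, finsetSum_coeff] at hc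
  refine Eq.trans (Finset.sum_congr rfl fun l hl => ?_)
    (hc.trans (Finset.sum_congr rfl fun l hl => ?_))
  · have : (1 + X : R[X]) ^ m * ((C x * (1 + X)) ^ l * C (1 - x) ^ (m - l) * (m.choose l : R[X])) =
        C (x ^ l * (1 - x) ^ (m - l) * m.choose l) * (1 + X) ^ (m + l) := by
      simp only [C_mul, C_pow, map_natCast, mul_pow]
      ring
    rw [this, coeff_C_mul, coeff_one_add_X_pow, Nat.choose_symm_add]
    ring
  · have hl' : l ≤ m := by simpa [Nat.lt_succ_iff] using hl
    have : (1 + X : R[X]) ^ m * ((C x * X) ^ l * 1 ^ (m - l) * (m.choose l : R[X])) =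
        C (x ^ l * m.choose l) * ((1 + X) ^ m * X ^ l) := by
      simp only [C_mul, C_pow, map_natCast, one_pow]
      ring
    rw [this, coeff_C_mul, coeff_mul_X_pow', if_pos hl', coeff_one_add_X_pow, Nat.choose_symm hl']
    ring

/-- The Hankel determinant of the moments `∫_X^1 t ^ (n + 1) dt`. -/
theorem choose_mul_det_hankel_moments {K : Type*} [Field K] (m : ℕ)
    (hK : ∀ n : ℕ, 0 < n → n ≤ 2 * m → (n : K) ≠ 0) :
    C (((2 * m).choose m : K)) *
      (Matrix.of fun k l : Fin m => C ((((k : ℕ) + l + 2 : ℕ) : K)⁻¹) *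
        (1 - (X : K[X]) ^ ((k : ℕ) + l + 2))).det =
    C ((Matrix.of fun i j : Fin m => (((i : ℕ) + j + 1 : ℕ) : K)⁻¹).det) *
      (1 - X) ^ (m ^ 2) *
      ∑ k ∈ Finset.range (m + 1), C ((m.choose k : K) ^ 2) * X ^ k := by
  set h : ℕ → K[X] := fun n => C (((n + 1 : ℕ) : K)⁻¹) * (1 - X) ^ (n + 1) with hh
  set φ : K[X][X] →ₗ[K[X]] K[X] := (basisMonomials K[X]).constr K[X] h with hφ
  have hφX (n : ℕ) : φ (X ^ n) = h n := by
    have := (basisMonomials K[X]).constr_basis K[X] h n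
    simpa only [coe_basisMonomials, monomial_one_right_eq_X_pow] using this
  have hmoment (n : ℕ) (hn : n + 1 ≤ 2 * m) :
      φ ((X + C X) ^ n) = C (((n + 1 : ℕ) : K)⁻¹) * (1 - X ^ (n + 1)) := by
    have hne : ((n + 1 : ℕ) : K) ≠ 0 := hK _ (by omega) hn
    have hb : (1 : K[X]) = X ^ (n + 1) + ∑ a ∈ Finset.range (n + 1),
        (1 - X) ^ (a + 1) * X ^ (n - a) * ((n + 1).choose (a + 1) : K[X]) := by
      have := add_pow (1 - X : K[X]) X (n + 1)
      rw [sub_add_cancel, one_pow, Finset.sum_range_succ'] at this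
      simpa [add_comm] using this
    have hb' : (1 : K[X]) - X ^ (n + 1) = _ := sub_eq_iff_eq_add'.2 hb
    rw [hb', add_pow, map_sum, Finset.mul_sum]
    refine Finset.sum_congr rfl fun a ha => ?_
    have ha' : a < n + 1 := Finset.mem_range.1 ha
    have hane : ((a + 1 : ℕ) : K) ≠ 0 := hK _ (by omega) (by omega)
    have h1 : (X : K[X][X]) ^ a * C X ^ (n - a) * (n.choose a : K[X][X]) =
        (X ^ (n - a) * (n.choose a : K[X])) • X ^ a := by
      rw [smul_eq_C_mul, C_mul, C_pow, map_natCast]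
      ring
    have h2 : ((n.choose a : ℕ) : K) * ((a + 1 : ℕ) : K)⁻¹ =
        ((n + 1 : ℕ) : K)⁻¹ * ((n + 1).choose (a + 1) : ℕ) := by
      have : ((n + 1 : ℕ) : K) * (n.choose a : ℕ) = ((n + 1).choose (a + 1) : ℕ) * (a + 1 : ℕ) := by
        rw [← Nat.cast_mul, ← Nat.cast_mul, Nat.add_one_mul_choose_eq]
      field_simp
      linear_combination this
    have h3 := congrArg (C : K → K[X]) h2
    rw [C_mul, C_mul, map_natCast, map_natCast] at h3
    rw [h1, map_smul, hφX, hh, smul_eq_mul]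
    linear_combination (1 - X) ^ (a + 1) * X ^ (n - a) * h3
  have hshift := det_hankel_X_add_C (φ ∘ₗ LinearMap.mulLeft K[X] (X + C X)) (X : K[X]) m
  simp only [LinearMap.comp_apply, LinearMap.mulLeft_apply, ← pow_succ'] at hshift
  have hM : (Matrix.of fun k l : Fin m => C ((((k : ℕ) + l + 2 : ℕ) : K)⁻¹) *
        (1 - (X : K[X]) ^ ((k : ℕ) + l + 2))) =
      Matrix.of fun k l : Fin m => φ ((X + C X) ^ ((k : ℕ) + l + 1)) := by
    ext1 k l
    rw [Matrix.of_apply, Matrix.of_apply, hmoment _ (by omega)]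
  have hN : (Matrix.of fun k l : Fin m => φ ((X + C X) * X ^ ((k : ℕ) + l))) =
      Matrix.of fun k l : Fin m => h ((k : ℕ) + l + 1) - (-X) * h ((k : ℕ) + l) := by
    ext1 k l
    rw [Matrix.of_apply, Matrix.of_apply, add_mul, ← pow_succ', map_add, hφX, ← smul_eq_C_mul,
      map_smul, hφX, smul_eq_mul]
    ring
  have hchr := det_hankel_christoffel m h
    (fun l => C ((-1) ^ l * (m.choose l : K) * ((m + l).choose l : K)) * (1 - X) ^ (m - l)) (-X) (by
      intro k hk
      have := congrArg (fun t => (1 - X : K[X]) ^ (m + k + 1) * C t)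
        (sum_legendre_mul_inv_eq_zero m hK k hk)
      simp only [C_0, mul_zero, map_sum, Finset.mul_sum] at this
      refine Eq.trans (Finset.sum_congr rfl fun l hl => ?_) this
      have hl' : l ≤ m := by simpa [Nat.lt_succ_iff] using hl
      have he : m + k + 1 = (m - l) + (k + l + 1) := by omega
      simp only [hh, he, pow_add (1 - X : K[X]) (m - l), C_mul]
      ring)
  have hhil : (Matrix.of fun k l : Fin m => h ((k : ℕ) + l)).det = (1 - X) ^ (m ^ 2) *
      C ((Matrix.of fun i j : Fin m => (((i : ℕ) + j + 1 : ℕ) : K)⁻¹).det) := by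
    rw [RingHom.map_det, ← det_pow_scale]
    congr 1
    ext1 k l
    simp only [Matrix.of_apply, hh, RingHom.mapMatrix_apply, Matrix.map_apply]
    ring
  have hhasse : ∑ l ∈ Finset.range (m + 1),
      C ((-1) ^ l * (m.choose l : K) * ((m + l).choose l : K)) * (1 - X) ^ (m - l) * (-X) ^ l =
      ∑ k ∈ Finset.range (m + 1), C ((m.choose k : K) ^ 2) * X ^ k := by
    simp only [C_pow, map_natCast, C_mul, map_neg, map_one]
    rw [← sum_choose_mul_choose_eq_hasse]
    refine Finset.sum_congr rfl fun l _ => ?_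
    have : ((-1 : K[X]) ^ l) * (-1) ^ l = 1 := by rw [← mul_pow]; simp
    rw [neg_pow (X : K[X]) l]
    linear_combination (m.choose l : K[X]) * ((m + l).choose l : K[X]) * (1 - X) ^ (m - l) *
      X ^ l * this
  have hsC : (C ((-1 : K) ^ m) : K[X]) = (-1) ^ m := by simp
  rw [hhasse, hhil, ← hN, ← hshift, ← hM, Nat.sub_self, pow_zero, mul_one, ← two_mul,
    Nat.choose_self, Nat.cast_one, mul_one, C_mul, hsC] at hchr
  refine mul_left_cancel₀ (pow_ne_zero m (by simp) : (-1 : K[X]) ^ m ≠ 0) ?_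
  linear_combination hchr

/-- For an odd prime `p` and `m = (p - 1) / 2`: with `A` the `m × m` matrix over
`(ZMod p)[X]` with `(i, j)` entry `(i + j + 1)⁻¹ * (X ^ (i + j + 1) - X ^ p)` and
`H_p(X) = ∑_{k = 0}^{m} C(m, k)² X^k` the Hasse polynomial, there is a nonzero constant
`c ∈ ZMod p` with `det A = c * X ^ (m²) * (1 - X) ^ (m²) * H_p(X)`. -/
theorem stmt14 (p : ℕ) (hp : p.Prime) (hodd : Odd p) :
    ∃ c : ZMod p, c ≠ 0 ∧
      (Matrix.of fun i j : Fin ((p - 1) / 2) =>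
          C (((((i : ℕ) + (j : ℕ) + 1 : ℕ)) : ZMod p)⁻¹) *
            ((X : (ZMod p)[X]) ^ ((i : ℕ) + (j : ℕ) + 1) - (X : (ZMod p)[X]) ^ p)).det =
        C c * (X : (ZMod p)[X]) ^ (((p - 1) / 2) ^ 2) *
          (1 - (X : (ZMod p)[X])) ^ (((p - 1) / 2) ^ 2) *
          ∑ k ∈ Finset.range ((p - 1) / 2 + 1),
            C (((Nat.choose ((p - 1) / 2) k : ℕ) : ZMod p) ^ 2) * (X : (ZMod p)[X]) ^ k := by
  have : Fact p.Prime := ⟨hp⟩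
  obtain ⟨m, hm⟩ := hodd
  have hpm : (p - 1) / 2 = m := by omega
  rw [hpm]
  have hK : ∀ n : ℕ, 0 < n → n ≤ 2 * m → (n : ZMod p) ≠ 0 := by
    intro n hn hn' h
    have := Nat.le_of_dvd hn ((ZMod.natCast_eq_zero_iff n p).1 h)
    omega
  have hch : ((2 * m).choose m : ZMod p) ≠ 0 := by
    rw [Ne, ZMod.natCast_eq_zero_iff]
    intro h
    have := (hp.dvd_factorial).1 (h.trans (Nat.choose_mul_factorial_mul_factorial
      (show m ≤ 2 * m by omega) ▸ Dvd.intro _ (mul_assoc _ _ _).symm))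
    omega
  have hmain := choose_mul_det_hankel_moments m hK
  set D := (Matrix.of fun i j : Fin m => (((i : ℕ) + j + 1 : ℕ) : ZMod p)⁻¹).det
  set M : Matrix (Fin m) (Fin m) (ZMod p)[X] :=
    Matrix.of fun k l : Fin m => C ((((k : ℕ) + l + 2 : ℕ) : ZMod p)⁻¹) *
        (1 - (X : (ZMod p)[X]) ^ ((k : ℕ) + l + 2)) with hMdef
  have hA : (Matrix.of fun i j : Fin m =>
          C (((((i : ℕ) + (j : ℕ) + 1 : ℕ)) : ZMod p)⁻¹) *
            ((X : (ZMod p)[X]) ^ ((i : ℕ) + (j : ℕ) + 1) - (X : (ZMod p)[X]) ^ p)) =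
      Matrix.of fun i j : Fin m => X ^ ((i : ℕ) + j + 1) *
        (-(M.submatrix Fin.revPerm Fin.revPerm)) i j := by
    ext1 i j
    have hsum : ((i : ℕ) + j + 1) + ((Fin.rev i : ℕ) + (Fin.rev j : ℕ) + 2) = p := by
      rw [Fin.val_rev, Fin.val_rev]; omega
    simp only [Matrix.of_apply, hMdef, Matrix.neg_apply, Matrix.submatrix_apply, Fin.revPerm_apply]
    set a := (i : ℕ) + j + 1
    set b := (Fin.rev i : ℕ) + (Fin.rev j : ℕ) + 2
    have hab : (a : ZMod p) = -(b : ZMod p) := by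
      rw [eq_neg_iff_add_eq_zero, ← Nat.cast_add, hsum, ZMod.natCast_self]
    have hX : (X : (ZMod p)[X]) ^ p = X ^ a * X ^ b := by rw [← pow_add, hsum]
    rw [hab, inv_neg, C_neg, hX]
    ring
  have hC : (C (((2 * m).choose m : ZMod p)⁻¹) : (ZMod p)[X]) *
      C ((2 * m).choose m : ZMod p) = 1 := by
    rw [← C_mul, inv_mul_cancel₀ hch, C_1]
  refine ⟨(-1) ^ m * ((2 * m).choose m : ZMod p)⁻¹ * D, ?_, ?_⟩
  · exact mul_ne_zero (mul_ne_zero (pow_ne_zero _ (by simp)) (inv_ne_zero hch))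
      (det_hilbert_ne_zero m hK)
  · rw [hA, det_pow_scale, Matrix.det_neg, Matrix.det_submatrix_equiv_self, Fintype.card_fin]
    simp only [C_mul (R := ZMod p), C_pow, C_neg, C_1] at hmain ⊢
    linear_combination (X : (ZMod p)[X]) ^ (m ^ 2) * (-1) ^ m *
      C (((2 * m).choose m : ZMod p)⁻¹) * hmain - X ^ (m ^ 2) * (-1) ^ m * M.det * hC
end
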